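/- Let ρ be as in the Abelian upper-bound setting and let L = p₁^{n₁}⋯p_t^{n_t} be the prime factorization of L with p₁ < ⋯ < p_t and n₁ ≤ ⋯ ≤ n_t. Then for every difference d ≥ 1, the fixed point v satisfies A(d) ≤ L^{N+1}·d^B, where B = log L/(n₁ log p₁) and N is as above. In particular, if L is a prime power, A(d) grows at most linearly: A(d) ≤ L^{N+1} d. -/

import Mathlib

/-- The `k`-th letter of `ρ^n(a)` for a constant-length-`L` substitution. -/
def substPowLetter {A : Type*} (L : ℕ) (ρ : A → ℕ → A) : ℕ → A → ℕ → A
  | 0, a, _ => a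
  | n+1, a, k => ρ (substPowLetter L ρ n a (k / L)) (k % L)

/-- `w` is a one-sided fixed point of the constant-length-`L` substitution `ρ`. -/
def SubstFixedPoint {A : Type*} (L : ℕ) (ρ : A → ℕ → A) (w : ℕ → A) : Prop :=
  ∀ m i, i < L → w (L * m + i) = ρ (w m) i

/-- `ρ` is primitive: some power of `ρ` maps every letter to a word
containing every letter. -/
def SubstPrimitive {A : Type*} (L : ℕ) (ρ : A → ℕ → A) : Prop :=
  ∃ n, ∀ a b : A, ∃ k, k < L ^ n ∧ substPowLetter L ρ n a k = b

/-- `ρ` is aperiodic: it admits no (purely) periodic fixed point. -/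
def SubstAperiodic {A : Type*} (L : ℕ) (ρ : A → ℕ → A) : Prop :=
  ∀ w : ℕ → A, SubstFixedPoint L ρ w → ¬ ∃ p, 1 ≤ p ∧ ∀ j, w (j + p) = w j

/-- `(x, y)` is a legal two-letter word of `ρ`: it occurs in some `ρ^n(b)`. -/
def Legal2 {A : Type*} (L : ℕ) (ρ : A → ℕ → A) (x y : A) : Prop :=
  ∃ (b : A) (n k : ℕ), k + 1 < L ^ n ∧
    substPowLetter L ρ n b k = x ∧ substPowLetter L ρ n b (k + 1) = y

/-- Every legal two-letter word of `ρ` occurs in `ρ^N(a)` for every letter `a`. -/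
def ContainsAllLegal2 {A : Type*} (L : ℕ) (ρ : A → ℕ → A) (N : ℕ) : Prop :=
  ∀ (a x y : A), Legal2 L ρ x y → ∃ k, k + 1 < L ^ N ∧
    substPowLetter L ρ N a k = x ∧ substPowLetter L ρ N a (k + 1) = y

def phiP {A : Type*} (L : ℕ) (σ : ℕ → Equiv.Perm A) : ℕ → ℕ → Equiv.Perm A
  | 0, _ => 1
  | n+1, k => σ (k % L) * phiP L σ n (k / L)

lemma subst_eq_phiP {A : Type*} (L : ℕ) (σ : ℕ → Equiv.Perm A) (n : ℕ) (a : A) (k : ℕ) :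
    substPowLetter L (fun a i => σ i a) n a k = phiP L σ n k a := by
  induction n generalizing k with
  | zero => simp [substPowLetter, phiP]
  | succ n ih => simp [substPowLetter, phiP, ih]

lemma phiP_comm {A : Type*} (L : ℕ) (hL : 2 ≤ L) (σ : ℕ → Equiv.Perm A)
    (habel : ∀ i < L, ∀ j < L, σ i * σ j = σ j * σ i) (n k m l : ℕ) :
    Commute (phiP L σ n k) (phiP L σ m l) := by
  have h1 : ∀ i < L, ∀ m l, Commute (σ i) (phiP L σ m l) := by
    intro i hi m
    induction m with
    | zero => intro l; exact Commute.one_right _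
    | succ m ih =>
      intro l
      exact Commute.mul_right (habel i hi _ (Nat.mod_lt _ (by omega))) (ih _)
  induction n generalizing k with
  | zero => exact Commute.one_left _
  | succ n ih => exact Commute.mul_left (h1 _ (Nat.mod_lt _ (by omega)) _ _) (ih _)

lemma fixed_phiP {A : Type*} (L : ℕ) (hL : 2 ≤ L) (σ : ℕ → Equiv.Perm A)
    (v : ℕ → A) (hv : SubstFixedPoint L (fun a i => σ i a) v) (n q r : ℕ) (hr : r < L ^ n) :
    v (L ^ n * q + r) = phiP L σ n r (v q) := by
  induction n generalizing r with
  | zero =>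
    have : r = 0 := by simpa using hr
    simp [phiP, this]
  | succ n ih =>
    have h1 : r / L < L ^ n := by
      apply Nat.div_lt_of_lt_mul; rwa [pow_succ, mul_comm] at hr
    have h2 : L ^ (n+1) * q + r = L * (L ^ n * q + r / L) + r % L := by
      conv_lhs => rw [← Nat.div_add_mod r L]
      ring
    rw [h2, hv _ _ (Nat.mod_lt _ (by omega)), ih _ h1]
    simp [phiP]

lemma hit_residue (d P s x : ℕ) (hP : 0 < P) (h : x ≡ s [MOD Nat.gcd d P]) (hx : x < P) :
    ∃ j < P, (s + j * d) % P = x := by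
  obtain ⟨y, hy⟩ := (Nat.modEq_iff_dvd.1 h.symm)
  have hb := Nat.gcd_eq_gcd_ab d P
  have hP' : (P : ℤ) ≠ 0 := by exact_mod_cast hP.ne'
  refine ⟨((y * Nat.gcdA d P) % P).toNat, ?_, ?_⟩
  · have := Int.emod_lt_of_pos (y * Nat.gcdA d P) (by exact_mod_cast hP : (0:ℤ) < P)
    have := Int.emod_nonneg (y * Nat.gcdA d P) hP'
    omega
  · have h0 := Int.emod_nonneg (y * Nat.gcdA d P) hP'
    have : (s + ((y * Nat.gcdA d P) % P).toNat * d) ≡ x [MOD P] := by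
      apply (Nat.modEq_iff_dvd).2
      push_cast
      rw [Int.toNat_of_nonneg h0]
      have h3 := Int.emod_add_mul_ediv (y * Nat.gcdA d P) P
      refine ⟨y * Nat.gcdB d P + d * ((y * Nat.gcdA d P) / P), ?_⟩
      have h4 : (y * Nat.gcdA d P) % P = y * Nat.gcdA d P - P * ((y * Nat.gcdA d P) / P) := by
        linarith
      rw [h4]
      have h5 : (x : ℤ) = s + (d * Nat.gcdA d P + P * Nat.gcdB d P) * y := by
        rw [← hb]; linarith
      rw [h5]; ring
    rw [this, Nat.mod_eq_of_lt hx]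

lemma core_bound {A : Type*} [Fintype A]
    (L : ℕ) (hL : 2 ≤ L) (σ : ℕ → Equiv.Perm A)
    (hprim : SubstPrimitive L (fun a i => σ i a))
    (haper : SubstAperiodic L (fun a i => σ i a))
    (habel : ∀ i < L, ∀ j < L, σ i * σ j = σ j * σ i)
    (v : ℕ → A) (hv : SubstFixedPoint L (fun a i => σ i a) v)
    (N : ℕ) (hN : ContainsAllLegal2 L (fun a i => σ i a) N)
    (d : ℕ) (hd : 1 ≤ d) (m : ℕ) (hdm : d < L ^ m) (hg : Nat.gcd d (L ^ (N + m)) ∣ L ^ m)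
    (s M : ℕ) (hM : ∀ j < M, v (s + j * d) = v s) : M ≤ L ^ (N + m) := by
  by_contra hcon
  push Not at hcon
  set P := L ^ (N + m) with hPdef
  set g := Nat.gcd d P with hgdef
  have hPpos : 0 < P := by positivity
  have hgpos : 0 < g := Nat.gcd_pos_of_pos_left _ hd
  have hgd : g ∣ d := Nat.gcd_dvd_left _ _
  have hgled : g ≤ d := Nat.le_of_dvd hd hgd
  -- the residue r
  obtain ⟨r, hrlt, hrge, hrs⟩ : ∃ r, r < L ^ m ∧ L ^ m ≤ r + d ∧ r ≡ s [MOD g] := by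
    have h1 := Nat.mod_lt s hgpos
    refine ⟨L ^ m - g + s % g, by omega, by omega, ?_⟩
    have h2 : g ∣ L ^ m - g := Nat.dvd_sub hg dvd_rfl
    have h3 : L ^ m - g ≡ 0 [MOD g] := (Nat.modEq_zero_iff_dvd).2 h2
    simpa using h3.add (Nat.mod_modEq s g)
  obtain ⟨r', hr'⟩ := Nat.exists_eq_add_of_le hrge
  have hr'lt : r' < L ^ m := by omega
  set c : Equiv.Perm A := (phiP L σ m r')⁻¹ * phiP L σ m r with hc
  have hcc : ∀ n k, Commute c (phiP L σ n k) := fun n k =>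
    Commute.mul_left ((phiP_comm L hL σ habel _ _ _ _).inv_left) (phiP_comm L hL σ habel _ _ _ _)
  have key : ∀ q, q + 1 < L ^ N → ∀ a, phiP L σ N (q+1) a = c (phiP L σ N q a) := by
    intro q hq
    have hx : L ^ m * q + r < P := by
      have : L ^ m * (q + 1) ≤ L ^ m * L ^ N := Nat.mul_le_mul_left _ hq.le
      rw [hPdef, pow_add, mul_comm (L ^ N)]
      rw [mul_add] at this; omega
    have hxs : L ^ m * q + r ≡ s [MOD g] := by
      have h3 : L ^ m * q ≡ 0 [MOD g] := (Nat.modEq_zero_iff_dvd).2 (hg.mul_right q)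
      simpa using h3.add hrs
    obtain ⟨j, hj, hjx⟩ := hit_residue d P s _ hPpos hxs hx
    set Q := (s + j * d) / P
    have e1 : s + j * d = L ^ m * (L ^ N * Q + q) + r := by
      have h9 : P * Q + (s + j * d) % P = s + j * d := Nat.div_add_mod (s + j * d) P
      have h10 : P = L ^ N * L ^ m := by rw [hPdef, pow_add]
      rw [hjx, h10] at h9
      rw [← h9]; ring
    have e2 : s + (j + 1) * d = L ^ m * (L ^ N * Q + (q + 1)) + r' := by
      have : s + (j + 1) * d = (s + j * d) + d := by ring
      rw [this, e1, add_assoc, hr']; ring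
    have v1 := hM j (by omega)
    have v2 := hM (j+1) (by omega)
    rw [e1, fixed_phiP L hL σ v hv _ _ _ hrlt, fixed_phiP L hL σ v hv _ _ _ (by omega)] at v1
    rw [e2, fixed_phiP L hL σ v hv _ _ _ hr'lt, fixed_phiP L hL σ v hv _ _ _ hq] at v2
    have h0 : phiP L σ N (q+1) (v Q) = c (phiP L σ N q (v Q)) := by
      rw [hc, Equiv.Perm.mul_apply, v1, ← v2]; simp
    intro a
    obtain ⟨n, hn⟩ := hprim
    obtain ⟨k, -, hk⟩ := hn (v Q) a
    rw [subst_eq_phiP] at hk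
    rw [← hk, ← Equiv.Perm.mul_apply, (phiP_comm L hL σ habel _ _ _ _).eq, Equiv.Perm.mul_apply, h0,
      ← Equiv.Perm.mul_apply, ← Equiv.Perm.mul_apply, ← Equiv.Perm.mul_apply,
      ← Equiv.Perm.mul_apply]
    congr 1
    exact ((hcc n k).symm.mul_right (phiP_comm L hL σ habel n k N q)).eq
  have step : ∀ n, v (n + 1) = c (v n) := by
    intro n
    have hlt : n + 1 < L ^ (n + 1) := Nat.lt_pow_self (by omega)
    have e0 : ∀ k < L ^ (n+1), phiP L σ (n+1) k (v 0) = v k := by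
      intro k hk
      have := fixed_phiP L hL σ v hv (n+1) 0 k hk
      rw [← this]; simp
    obtain ⟨k, hk, h1, h2⟩ := hN (v 0) (v n) (v (n+1)) ⟨v 0, n+1, n, hlt, by
      rw [subst_eq_phiP, e0 _ (by omega)], by rw [subst_eq_phiP, e0 _ hlt]⟩
    rw [subst_eq_phiP] at h1 h2
    rw [← h1, ← h2, key k hk]
  have iter : ∀ i n, v (n + i) = (c ^ i) (v n) := by
    intro i
    induction i with
    | zero => intro n; simp
    | succ i ih => intro n; rw [← add_assoc, step, ih, pow_succ']; rfl
  refine haper v hv ⟨orderOf c, orderOf_pos c, fun j => ?_⟩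
  rw [iter, pow_orderOf_eq_one]; rfl

/-- in the Abelian upper-bound setting, if
`L = p₁^{n₁}⋯p_t^{n_t}` with `p₁ < ⋯ < p_t` and `n₁ ≤ ⋯ ≤ n_t`, then for
every `d ≥ 1`, `A(d) ≤ L^{N+1}·d^B` where `B = log L/(n₁ log p₁)`. -/
theorem abelian_polynomial_upper_bound {A : Type*} [Fintype A]
    (L : ℕ) (hL : 2 ≤ L) (σ : ℕ → Equiv.Perm A) (hσ0 : σ 0 = 1)
    (hprim : SubstPrimitive L (fun a i => σ i a))
    (haper : SubstAperiodic L (fun a i => σ i a))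
    (habel : ∀ i < L, ∀ j < L, σ i * σ j = σ j * σ i)
    (v : ℕ → A) (hv : SubstFixedPoint L (fun a i => σ i a) v)
    (N : ℕ) (hN : ContainsAllLegal2 L (fun a i => σ i a) N)
    (hNmin : ∀ m, ContainsAllLegal2 L (fun a i => σ i a) m → N ≤ m)
    (t : ℕ) (ht : 0 < t) (p e : Fin t → ℕ)
    (hp : ∀ i, (p i).Prime) (hpmono : StrictMono p)
    (hemono : Monotone e) (he1 : ∀ i, 1 ≤ e i)
    (hfact : L = ∏ i, p i ^ e i)
    (d : ℕ) (hd : 1 ≤ d) :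
    ∀ s M : ℕ, (∀ j < M, v (s + j * d) = v s) →
      (M : ℝ) ≤ (L : ℝ) ^ (N + 1) *
        (d : ℝ) ^ (Real.log L / ((e ⟨0, ht⟩ : ℝ) * Real.log (p ⟨0, ht⟩))) := by
  intro s M hM
  set i0 : Fin t := ⟨0, ht⟩ with hi0
  set b := p i0 ^ e i0 with hb
  have hmono : ∀ i, b ≤ p i ^ e i := fun i => by
    have h0 : i0 ≤ i := Fin.mk_le_of_le_val (Nat.zero_le _)
    exact (Nat.pow_le_pow_left (hpmono.monotone h0) _).trans
      (Nat.pow_le_pow_right (hp i).pos (hemono h0))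
  have hb2 : 1 < b := Nat.one_lt_pow (by have := he1 i0; omega) (hp i0).one_lt
  have hdvd : ∀ i, p i ^ e i ∣ L := fun i => by
    rw [hfact]; exact Finset.dvd_prod_of_mem (fun i => p i ^ e i) (Finset.mem_univ i)
  obtain ⟨m, hm1, hm2⟩ : ∃ m, b ^ m ≤ d ∧ d < b ^ (m + 1) :=
    ⟨Nat.log b d, Nat.pow_log_le_self b (by omega), Nat.lt_pow_succ_log_self hb2 d⟩
  have hbL : b ≤ L := Nat.le_of_dvd (by omega) (hdvd i0)
  have hg : Nat.gcd d (L ^ (N + (m + 1))) ∣ L ^ (m + 1) := by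
    rw [Nat.dvd_iff_prime_pow_dvd_dvd]
    intro q k hq hk
    rcases Nat.eq_zero_or_pos k with rfl | hkpos
    · simp
    have hqd : q ^ k ∣ d := hk.trans (Nat.gcd_dvd_left _ _)
    have hqL : q ∣ L := hq.dvd_of_dvd_pow
      ((dvd_pow_self q hkpos.ne').trans (hk.trans (Nat.gcd_dvd_right _ _)))
    rw [hfact] at hqL
    obtain ⟨i, -, hi⟩ := (hq.prime.dvd_finsetProd_iff _).1 hqL
    have hqi : q = p i := (Nat.prime_dvd_prime_iff_eq hq (hp i)).1 (hq.dvd_of_dvd_pow hi)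
    subst hqi
    have hlt : p i ^ k < p i ^ (e i * (m + 1)) := by
      calc p i ^ k ≤ d := Nat.le_of_dvd hd hqd
        _ < b ^ (m + 1) := hm2
        _ ≤ (p i ^ e i) ^ (m + 1) := Nat.pow_le_pow_left (hmono i) _
        _ = _ := by rw [pow_mul]
    have hk2 : k < e i * (m + 1) := (Nat.pow_lt_pow_iff_right (hp i).one_lt).1 hlt
    refine (pow_dvd_pow _ hk2.le).trans ?_
    rw [pow_mul]
    exact pow_dvd_pow_of_dvd (hdvd i) _
  have hbound := core_bound L hL σ hprim haper habel v hv N hN d hd (m + 1)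
    (hm2.trans_le (Nat.pow_le_pow_left hbL _)) hg s M hM
  have hlogb : (e i0 : ℝ) * Real.log (p i0) = Real.log b := by
    rw [hb]; push_cast; rw [Real.log_pow]
  rw [hlogb]
  have hb1 : (1:ℝ) < b := by exact_mod_cast hb2
  have hlb : 0 < Real.log b := Real.log_pos hb1
  have hLpos : (0:ℝ) < L := by positivity
  have hB : (0:ℝ) ≤ Real.log L / Real.log b :=
    div_nonneg (Real.log_natCast_nonneg L) hlb.le
  have hpow : (L : ℝ) ^ m ≤ (d : ℝ) ^ (Real.log L / Real.log b) := by
    calc (L : ℝ) ^ m = ((b : ℝ) ^ m) ^ (Real.log L / Real.log b) := by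
          rw [← Real.rpow_natCast, ← Real.rpow_natCast, ← Real.rpow_mul (by positivity),
            Real.rpow_def_of_pos hLpos, Real.rpow_def_of_pos (by positivity)]
          congr 1
          field_simp
      _ ≤ _ := Real.rpow_le_rpow (by positivity) (by exact_mod_cast hm1) hB
  calc (M : ℝ) ≤ (L : ℝ) ^ (N + (m + 1)) := by exact_mod_cast hbound
    _ = (L : ℝ) ^ (N + 1) * (L : ℝ) ^ m := by ring
    _ ≤ _ := by gcongr
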